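/- Suppose p ∈ (0,∞)^n is a pure Nash equilibrium of the price competition game, i.e. for every seller i and every q ≥ 0, q · φ*_i(p[i := q]) ≤ p i · φ*_i(p). Then β i · p i · (1 − φ*_i(p)) = 1 − r for every i ∈ {1,…,n}. -/

import Mathlib

/-- Asymptotic market share of product `i` at price vector `p`. -/
noncomputable def marketShare (n : ℕ) (g β : Fin n → ℝ) (r : ℝ) (p : Fin n → ℝ)
    (i : Fin n) : ℝ :=
  Real.exp ((g i - β i * p i) / (1 - r)) /
    (1 + ∑ j, Real.exp ((g j - β j * p j) / (1 - r)))

/-- The market share of product `i` as a function of its own price alone. -/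
theorem marketShare_update (n : ℕ) (g β : Fin n → ℝ) (r : ℝ) (p : Fin n → ℝ)
    (i : Fin n) (q : ℝ) :
    marketShare n g β r (Function.update p i q) i =
      Real.exp ((g i - β i * q) / (1 - r)) /
        ((1 + ∑ j ∈ Finset.univ.erase i, Real.exp ((g j - β j * p j) / (1 - r))) +
          Real.exp ((g i - β i * q) / (1 - r))) := by
  have hsum : ∑ j ∈ Finset.univ.erase i,
      Real.exp ((g j - β j * Function.update p i q j) / (1 - r)) =
        ∑ j ∈ Finset.univ.erase i, Real.exp ((g j - β j * p j) / (1 - r)) :=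
    Finset.sum_congr rfl fun j hj => by
      rw [Function.update_of_ne (Finset.ne_of_mem_erase hj)]
  rw [marketShare, ← Finset.sum_erase_add _ _ (Finset.mem_univ i), hsum,
    Function.update_self, add_assoc]

/-- The derivative of the revenue `x · e(x) / (S + e(x))`, where
`e(x) = exp ((a - b x) / c)`. -/
theorem hasDerivAt_logit_revenue (a b c S q : ℝ) (hS : 0 < S) :
    HasDerivAt
      (fun x => x * (Real.exp ((a - b * x) / c) / (S + Real.exp ((a - b * x) / c))))
      (Real.exp ((a - b * q) / c) / (S + Real.exp ((a - b * q) / c)) *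
        (1 - b / c * q *
          (1 - Real.exp ((a - b * q) / c) / (S + Real.exp ((a - b * q) / c))))) q := by
  have hpos : S + Real.exp ((a - b * q) / c) ≠ 0 :=
    (add_pos hS (Real.exp_pos _)).ne'
  have hexp : HasDerivAt (fun x => Real.exp ((a - b * x) / c))
      (Real.exp ((a - b * q) / c) * (-(b * 1) / c)) q :=
    ((((hasDerivAt_id q).const_mul b).const_sub a).div_const c).exp
  refine ((hasDerivAt_id q).mul (hexp.div (hexp.const_add S) hpos)).congr_deriv ?_
  simp only [id, Pi.div_apply]
  generalize Real.exp ((a - b * q) / c) = e at hpos ⊢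
  field_simp
  ring

/-- A positive pure Nash equilibrium of the price competition game satisfies
the first-order system `βᵢ pᵢ (1 − φ*ᵢ(p)) = 1 − r` for every `i`. -/
theorem nash_implies_first_order
    (n : ℕ) (hn : 2 ≤ n) (g β : Fin n → ℝ) (hβ : ∀ i, 0 < β i)
    (r : ℝ) (hr0 : 0 < r) (hr1 : r < 1)
    (p : Fin n → ℝ) (hp : ∀ i, 0 < p i)
    (hnash : ∀ i : Fin n, ∀ q : ℝ, 0 ≤ q →
      q * marketShare n g β r (Function.update p i q) i
        ≤ p i * marketShare n g β r p i) :
    ∀ i, β i * p i * (1 - marketShare n g β r p i) = 1 - r := by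
  intro i
  set S := 1 + ∑ j ∈ Finset.univ.erase i, Real.exp ((g j - β j * p j) / (1 - r))
  have hS : 0 < S :=
    add_pos_of_pos_of_nonneg one_pos (Finset.sum_nonneg fun j _ => (Real.exp_pos _).le)
  have hshare : marketShare n g β r p i =
      Real.exp ((g i - β i * p i) / (1 - r)) /
        (S + Real.exp ((g i - β i * p i) / (1 - r))) := by
    simpa only [Function.update_eq_self] using marketShare_update n g β r p i (p i)
  have hmax : IsLocalMax (fun x => x * (Real.exp ((g i - β i * x) / (1 - r)) /
      (S + Real.exp ((g i - β i * x) / (1 - r))))) (p i) := by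
    filter_upwards [lt_mem_nhds (hp i)] with q hq
    have h := hnash i q hq.le
    rwa [marketShare_update, hshare] at h
  have hzero := hmax.hasDerivAt_eq_zero
    (hasDerivAt_logit_revenue (g i) (β i) (1 - r) S (p i) hS)
  rw [← hshare] at hzero
  have hshare_pos : 0 < marketShare n g β r p i := by
    rw [hshare]
    positivity
  have hr : 1 - r ≠ 0 := (sub_pos.mpr hr1).ne'
  have hfoc := (mul_eq_zero.mp hzero).resolve_left hshare_pos.ne'
  field_simp at hfoc
  linarith
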